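/- arXiv:1912.01195 — 2 statements merged into one kernel-verified Lean document; each statement's English description precedes it below -/
import Mathlib

section
/- There exists an absolute constant c > 0 such that the following holds. Let F, C be disjoint finite sets with a metric d on F ∪ C, let T > 0 and k ∈ ℕ, and let (x, y) be a feasible solution to SC-LP(T, k). Then for every ε ∈ (0, 1) there exist integral functions x̂ : F × C → {0, 1} and ŷ : F → {0, 1} such that ∑_{i ∈ F} x̂_{ij} = 1 for every j ∈ C, x̂_{ij} ≤ ŷ_i for all i, j, ∑_{i ∈ F} ŷ_i ≤ (1 + ε)·k, and L(i, x̂) ≤ (c/ε²)·T·ŷ_i for every i ∈ F. -/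
/-- Feasibility for the LP relaxation `SC-LP(T, k)` of the star cover problem. -/
def SCLPFeasible {X : Type*} [MetricSpace X] (F C : Finset X) (T : ℝ) (k : ℕ)
    (x : X → X → ℝ) (y : X → ℝ) : Prop :=
  (∀ i ∈ F, ∀ j ∈ C, x i j ∈ Set.Icc (0 : ℝ) 1) ∧
  (∀ i ∈ F, y i ∈ Set.Icc (0 : ℝ) 1) ∧
  (∀ i ∈ F, ∑ j ∈ C, dist i j * x i j ≤ T * y i) ∧
  (∑ i ∈ F, y i ≤ (k : ℝ)) ∧
  (∀ j ∈ C, ∑ i ∈ F, x i j = 1) ∧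
  (∀ i ∈ F, ∀ j ∈ C, x i j ≤ y i) ∧
  (∀ i ∈ F, ∀ j ∈ C, T < dist i j → x i j = 0)

/-- Greedy selection of centers by increasing radius. -/
theorem exists_separated_centers {X : Type*} [PseudoMetricSpace X] (C : Finset X) (R : X → ℝ)
    (hR : ∀ j ∈ C, 0 ≤ R j) :
    ∃ S ⊆ C, (∀ s ∈ S, ∀ t ∈ S, s ≠ t → R s + R t < dist s t) ∧
      ∀ j ∈ C, ∃ s ∈ S, R s ≤ R j ∧ dist j s ≤ R j + R s := by
  classical
  induction C using Finset.induction_on_max_value R with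
  | empty => exact ⟨∅, by simp⟩
  | insert a C ha hmax ih =>
    obtain ⟨S, hSC, hsep, hcov⟩ := ih fun j hj ↦ hR j (Finset.mem_insert_of_mem hj)
    by_cases h : ∃ t ∈ S, dist a t ≤ R a + R t
    · obtain ⟨t, ht, hat⟩ := h
      refine ⟨S, hSC.trans (Finset.subset_insert _ _), hsep, fun j hj ↦ ?_⟩
      rcases Finset.mem_insert.1 hj with rfl | hj
      · exact ⟨t, ht, hmax t (hSC ht), hat⟩
      · exact hcov j hj
    · push Not at h
      refine ⟨insert a S, Finset.insert_subset_insert _ hSC, fun s hs t ht hst ↦ ?_,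
        fun j hj ↦ ?_⟩
      · rcases Finset.mem_insert.1 hs with rfl | hs' <;> rcases Finset.mem_insert.1 ht with rfl | ht'
        · exact absurd rfl hst
        · exact h t ht'
        · rw [dist_comm, add_comm]
          exact h s hs'
        · exact hsep s hs' t ht' hst
      · rcases Finset.mem_insert.1 hj with rfl | hj
        · exact ⟨j, Finset.mem_insert_self _ _, le_rfl, by
            rw [dist_self]; linarith [hR j hj]⟩
        · obtain ⟨s, hs, h⟩ := hcov j hj
          exact ⟨s, Finset.mem_insert_of_mem hs, h⟩

/-- Markov's inequality for a finite probability vector. -/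
theorem one_sub_le_sum_filter_le {α : Type*} (F : Finset α) (w g : α → ℝ) (a : ℝ) (ha : 0 < a)
    (hw : ∀ i ∈ F, 0 ≤ w i) (hg : ∀ i ∈ F, 0 ≤ g i) (hsum : ∑ i ∈ F, w i = 1) :
    1 - a ≤ ∑ i ∈ F with g i ≤ (∑ i ∈ F, g i * w i) / a, w i := by
  set μ := ∑ i ∈ F, g i * w i with hμ
  have hμ0 : 0 ≤ μ := Finset.sum_nonneg fun i hi ↦ mul_nonneg (hg i hi) (hw i hi)
  have hsplit := Finset.sum_filter_add_sum_filter_not F (fun i ↦ g i ≤ μ / a) w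
  suffices h : ∑ i ∈ F with ¬ g i ≤ μ / a, w i ≤ a by linarith
  rcases hμ0.eq_or_lt with h0 | hpos
  · refine le_of_eq_of_le (Finset.sum_eq_zero fun i hi ↦ ?_) ha.le
    obtain ⟨hiF, hi⟩ := Finset.mem_filter.1 hi
    rw [← h0, zero_div, not_le] at hi
    have := (Finset.sum_eq_zero_iff_of_nonneg
      fun i hi ↦ mul_nonneg (hg i hi) (hw i hi)).1 (hμ.symm.trans h0.symm) i hiF
    exact (mul_eq_zero.1 this).resolve_left hi.ne'
  · have h : (μ / a) * ∑ i ∈ F with ¬ g i ≤ μ / a, w i ≤ μ := by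
      rw [Finset.mul_sum]
      calc _ ≤ ∑ i ∈ F with ¬ g i ≤ μ / a, g i * w i := Finset.sum_le_sum fun i hi ↦ by
            obtain ⟨hiF, hi⟩ := Finset.mem_filter.1 hi
            exact mul_le_mul_of_nonneg_right (not_le.1 hi).le (hw i hiF)
        _ ≤ μ := Finset.sum_le_sum_of_subset_of_nonneg (Finset.filter_subset _ _)
            fun i hi _ ↦ mul_nonneg (hg i hi) (hw i hi)
    have h2 : (μ / a) * ∑ i ∈ F with ¬ g i ≤ μ / a, w i ≤ (μ / a) * a := by
      rwa [div_mul_cancel₀ _ ha.ne']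
    exact le_of_mul_le_mul_left h2 (div_pos hpos ha)

/-- The points of `G` with the `m` smallest values of `g`. -/
theorem exists_subset_card_smallest {α : Type*} (G : Finset α) (g : α → ℝ) (m : ℕ) :
    ∃ O ⊆ G, O.card ≤ m ∧ (O.card = m ∨ O = G) ∧ ∀ i' ∈ O, ∀ i ∈ G, i ∉ O → g i' ≤ g i := by
  classical
  induction m with
  | zero => exact ⟨∅, by simp⟩
  | succ m ih =>
    obtain ⟨O, hOG, hle, hcard, hmin⟩ := ih
    rcases (G \ O).eq_empty_or_nonempty with h | h
    · exact ⟨O, hOG, by omega, Or.inr (hOG.antisymm (Finset.sdiff_eq_empty_iff_subset.1 h)), hmin⟩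
    · obtain ⟨a, ha, hamin⟩ := Finset.exists_min_image (G \ O) g h
      obtain ⟨haG, haO⟩ := Finset.mem_sdiff.1 ha
      have hc := Finset.card_insert_of_notMem haO
      refine ⟨insert a O, Finset.insert_subset haG hOG, by omega, Or.inl ?_, ?_⟩
      · rcases hcard with hcard | rfl
        · omega
        · exact absurd haG haO
      · intro i' hi' i hi hiO
        rw [Finset.mem_insert, not_or] at hiO
        rcases Finset.mem_insert.1 hi' with rfl | hi'
        · exact hamin i (Finset.mem_sdiff.2 ⟨hi, hiO.2⟩)
        · exact hmin i' hi' i hi hiO.2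

/-- Bipartite fractional assignments can be rounded so that every class `(i, n)` receives at most
its fractional mass, rounded up. -/
theorem exists_assignment_card_le_ceil {α β γ : Type*} [DecidableEq α] [DecidableEq γ]
    (F : Finset α) (C : Finset β)
    (x : α → β → ℝ) (κ : α → β → γ) (hx : ∀ i ∈ F, ∀ j ∈ C, 0 ≤ x i j)
    (hsum : ∀ j ∈ C, ∑ i ∈ F, x i j = 1) :
    ∃ σ : C → α, (∀ j, σ j ∈ F ∧ 0 < x (σ j) j) ∧ ∀ i n,
      (Finset.univ.filter fun j : C ↦ σ j = i ∧ κ i j = n).card ≤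
        ⌈∑ j ∈ C with κ i j = n, x i j⌉₊ := by
  classical
  let m : α × γ → ℕ := fun q ↦ ⌈∑ j ∈ C with κ q.1 j = q.2, x q.1 j⌉₊
  let N : C → Finset (α × γ) := fun j ↦ (F.filter fun i ↦ 0 < x i j).image fun i ↦ (i, κ i j)
  let t : C → Finset ((_ : α × γ) × ℕ) := fun j ↦ (N j).sigma fun q ↦ Finset.range (m q)
  have hall : ∀ s : Finset C, s.card ≤ (s.biUnion t).card := by
    intro s
    have hst : s.biUnion t = (s.biUnion N).sigma fun q ↦ Finset.range (m q) := by
      ext ⟨q, r⟩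
      simp only [t, Finset.mem_biUnion, Finset.mem_sigma]
      tauto
    rw [hst, Finset.card_sigma]
    simp only [Finset.card_range]
    have hreal : (s.card : ℝ) ≤ ∑ q ∈ s.biUnion N, (m q : ℝ) := by
      calc (s.card : ℝ) = ∑ j ∈ s, ∑ i ∈ F with 0 < x i j, x i j := by
            rw [Finset.card_eq_sum_ones, Nat.cast_sum]
            refine Finset.sum_congr rfl fun j _ ↦ ?_
            rw [Nat.cast_one, ← hsum j j.2]
            refine (Finset.sum_filter_of_ne fun i hi h ↦ (hx i hi j j.2).lt_of_ne' h).symm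
        _ = ∑ j ∈ s, ∑ q ∈ s.biUnion N with q ∈ N j, x q.1 j := by
            refine Finset.sum_congr rfl fun j hj ↦ ?_
            rw [Finset.filter_mem_eq_inter,
              Finset.inter_eq_right.2 (Finset.subset_biUnion_of_mem N hj),
              Finset.sum_image fun a _ b _ h ↦ (Prod.ext_iff.1 h).1]
        _ = ∑ q ∈ s.biUnion N, ∑ j ∈ s with q ∈ N j, x q.1 j := by
            simp only [Finset.sum_filter]
            exact Finset.sum_comm
        _ ≤ ∑ q ∈ s.biUnion N, (m q : ℝ) := by
            refine Finset.sum_le_sum fun q hq ↦ ?_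
            have hqF : q.1 ∈ F := by
              obtain ⟨j, -, hj⟩ := Finset.mem_biUnion.1 hq
              obtain ⟨i, hi, rfl⟩ := Finset.mem_image.1 hj
              exact (Finset.mem_filter.1 hi).1
            refine le_trans ?_ (Nat.le_ceil _)
            refine le_of_eq_of_le (Finset.sum_map (s.filter fun j ↦ q ∈ N j)
              (Function.Embedding.subtype _) fun j ↦ x q.1 j).symm ?_
            refine Finset.sum_le_sum_of_subset_of_nonneg (fun j hj ↦ ?_)
              fun j hj _ ↦ hx _ hqF j (Finset.mem_filter.1 hj).1
            obtain ⟨j, hjs, rfl⟩ := Finset.mem_map.1 hj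
            obtain ⟨i, -, rfl⟩ := Finset.mem_image.1 (Finset.mem_filter.1 hjs).2
            exact Finset.mem_filter.2 ⟨j.2, rfl⟩
    exact_mod_cast hreal
  obtain ⟨f, hinj, hf⟩ := (Finset.all_card_le_biUnion_card_iff_exists_injective t).1 hall
  have hfN : ∀ j : C, ∃ i, i ∈ F ∧ 0 < x i j ∧ (f j).1 = (i, κ i j) := fun j ↦ by
    obtain ⟨i, hi, h⟩ := Finset.mem_image.1 (Finset.mem_sigma.1 (hf j)).1
    exact ⟨i, (Finset.mem_filter.1 hi).1, (Finset.mem_filter.1 hi).2, h.symm⟩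
  choose σ hσF hσx hσ using hfN
  refine ⟨σ, fun j ↦ ⟨hσF j, hσx j⟩, fun i n ↦ ?_⟩
  rw [← Finset.card_range ⌈_⌉₊]
  refine Finset.card_le_card_of_injOn (fun j ↦ (f j).2) (fun j hj ↦ ?_) fun j hj j' hj' h ↦ ?_
  · obtain ⟨-, rfl, rfl⟩ := Finset.mem_filter.1 hj
    have := (Finset.mem_sigma.1 (hf j)).2
    rw [hσ j] at this
    exact this
  · obtain ⟨-, rfl, rfl⟩ := Finset.mem_filter.1 hj
    obtain ⟨-, h1, h2⟩ := Finset.mem_filter.1 hj'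
    refine hinj (Sigma.ext ?_ (heq_of_eq h))
    rw [hσ j, hσ j', h1, h2]

/-- Makespan rounding with positive processing times. -/
theorem exists_assignment_load_le_of_pos {α β : Type*} [DecidableEq α]
    (F : Finset α) (C : Finset β) (x p : α → β → ℝ) (D : ℝ)
    (hx : ∀ i ∈ F, ∀ j ∈ C, 0 ≤ x i j) (hsum : ∀ j ∈ C, ∑ i ∈ F, x i j = 1)
    (hp : ∀ i ∈ F, ∀ j ∈ C, 0 < p i j) (hD : 0 ≤ D)
    (hpD : ∀ i ∈ F, ∀ j ∈ C, 0 < x i j → p i j ≤ D) :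
    ∃ σ : C → α, (∀ j, σ j ∈ F ∧ 0 < x (σ j) j) ∧ ∀ i ∈ F,
      ∑ j : C with σ j = i, p i j ≤ 2 * ∑ j ∈ C, p i j * x i j + 2 * D := by
  classical
  have hκ : ∀ i j, ∃ n : ℕ, i ∈ F → j ∈ C → 0 < x i j →
      p i j ≤ D * (1 / 2) ^ n ∧ D * (1 / 2) ^ n ≤ 2 * p i j := by
    intro i j
    by_cases h : i ∈ F ∧ j ∈ C ∧ 0 < x i j
    · obtain ⟨hi, hj, hpos⟩ := h
      have hp0 := hp i hi j hj
      have hle := hpD i hi j hj hpos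
      have hD0 : 0 < D := hp0.trans_le hle
      obtain ⟨n, hn1, hn2⟩ := exists_nat_pow_near_of_lt_one (div_pos hp0 hD0)
        ((div_le_one hD0).2 hle) (y := (1 / 2 : ℝ)) (by norm_num) (by norm_num)
      refine ⟨n, fun _ _ _ ↦ ⟨?_, ?_⟩⟩
      · rw [div_le_iff₀ hD0] at hn2
        linarith
      · rw [lt_div_iff₀ hD0, pow_succ] at hn1
        linarith
    · exact ⟨0, fun h1 h2 h3 ↦ absurd ⟨h1, h2, h3⟩ h⟩
  choose κ hκ using hκ
  obtain ⟨σ, hσ, hcard⟩ := exists_assignment_card_le_ceil F C x κ hx hsum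
  refine ⟨σ, hσ, fun i hi ↦ ?_⟩
  obtain ⟨M, hM⟩ : ∃ M : ℕ, ∀ j ∈ C, κ i j < M :=
    ⟨C.sup (κ i) + 1, fun j hj ↦ Nat.lt_succ_of_le (Finset.le_sup hj)⟩
  calc ∑ j : C with σ j = i, p i j
      ≤ ∑ j : C with σ j = i, D * (1 / 2) ^ κ i j := Finset.sum_le_sum fun j hj ↦ by
        obtain ⟨-, rfl⟩ := Finset.mem_filter.1 hj
        exact (hκ _ _ hi j.2 (hσ j).2).1
    _ = ∑ n ∈ Finset.range M, ∑ j : C with σ j = i ∧ κ i j = n, D * (1 / 2) ^ n := by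
        rw [← Finset.sum_fiberwise_of_maps_to (t := Finset.range M) (g := fun j : C ↦ κ i j)
          fun j _ ↦ Finset.mem_range.2 (hM j j.2)]
        refine Finset.sum_congr rfl fun n _ ↦ ?_
        rw [Finset.filter_filter]
        exact Finset.sum_congr rfl fun j hj ↦ by rw [(Finset.mem_filter.1 hj).2.2]
    _ ≤ ∑ n ∈ Finset.range M, ((∑ j ∈ C with κ i j = n, x i j) + 1) * (D * (1 / 2) ^ n) := by
        refine Finset.sum_le_sum fun n _ ↦ ?_
        rw [Finset.sum_const, nsmul_eq_mul]
        refine mul_le_mul_of_nonneg_right ?_ (by positivity)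
        refine (Nat.cast_le.2 (hcard i n)).trans (Nat.ceil_lt_add_one ?_).le
        exact Finset.sum_nonneg fun j hj ↦ hx i hi j (Finset.mem_filter.1 hj).1
    _ = ∑ n ∈ Finset.range M, ∑ j ∈ C with κ i j = n, x i j * (D * (1 / 2) ^ κ i j)
          + D * ∑ n ∈ Finset.range M, (1 / 2 : ℝ) ^ n := by
        rw [Finset.mul_sum, ← Finset.sum_add_distrib]
        refine Finset.sum_congr rfl fun n _ ↦ ?_
        rw [add_mul, one_mul, Finset.sum_mul]
        congr 1
        exact Finset.sum_congr rfl fun j hj ↦ by rw [(Finset.mem_filter.1 hj).2]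
    _ = ∑ j ∈ C, x i j * (D * (1 / 2) ^ κ i j) + D * ∑ n ∈ Finset.range M, (1 / 2 : ℝ) ^ n := by
        rw [Finset.sum_fiberwise_of_maps_to fun j hj ↦ Finset.mem_range.2 (hM j hj)]
    _ ≤ 2 * ∑ j ∈ C, p i j * x i j + 2 * D := by
        have hgeom := sum_geometric_two_le M
        refine add_le_add ?_ (by nlinarith)
        rw [Finset.mul_sum]
        refine Finset.sum_le_sum fun j hj ↦ ?_
        rcases (hx i hi j hj).eq_or_lt with h | h
        · simp [← h]
        · nlinarith [(hκ i j hi hj h).2]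

/-- Makespan rounding. -/
theorem exists_assignment_load_le {α β : Type*} [DecidableEq α]
    (F : Finset α) (C : Finset β) (x p : α → β → ℝ) (D : ℝ)
    (hx : ∀ i ∈ F, ∀ j ∈ C, 0 ≤ x i j) (hsum : ∀ j ∈ C, ∑ i ∈ F, x i j = 1)
    (hp : ∀ i ∈ F, ∀ j ∈ C, 0 ≤ p i j) (hD : 0 < D)
    (hpD : ∀ i ∈ F, ∀ j ∈ C, 0 < x i j → p i j ≤ D) :
    ∃ σ : C → α, (∀ j, σ j ∈ F ∧ 0 < x (σ j) j) ∧ ∀ i ∈ F,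
      ∑ j : C with σ j = i, p i j ≤ 2 * ∑ j ∈ C, p i j * x i j + 6 * D := by
  set δ : ℝ := D / (C.card + 1) with hδ
  have hcard : (0 : ℝ) < C.card + 1 := by positivity
  have hδ0 : 0 < δ := by positivity
  have hδD : C.card * δ + δ = D := by rw [hδ]; field_simp
  have hδC : 0 ≤ C.card * δ := by positivity
  obtain ⟨σ, hσ, hload⟩ := exists_assignment_load_le_of_pos F C x (fun i j ↦ p i j + δ) (2 * D)
    hx hsum (fun i hi j hj ↦ by linarith [hp i hi j hj]) (by linarith)
    (fun i hi j hj h ↦ by linarith [hpD i hi j hj h])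
  refine ⟨σ, hσ, fun i hi ↦ ?_⟩
  have h1 : ∑ j : C with σ j = i, p i j ≤ ∑ j : C with σ j = i, (p i j + δ) :=
    Finset.sum_le_sum fun j _ ↦ by linarith
  have h2 : ∑ j ∈ C, (p i j + δ) * x i j ≤ ∑ j ∈ C, p i j * x i j + C.card * δ := by
    rw [← nsmul_eq_mul, ← Finset.sum_const, ← Finset.sum_add_distrib]
    refine Finset.sum_le_sum fun j hj ↦ ?_
    have : x i j ≤ 1 := hsum j hj ▸ Finset.single_le_sum (fun i hi ↦ hx i hi j hj) hi
    nlinarith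
  linarith [hload i hi]

/-- In each cell `{i ∈ F | c i = s}` the (at most) `m s` points with smallest `g` are opened; the
demand of an unopened point is spread evenly over the opened points of its cell. -/
theorem exists_open_and_transport {α : Type*} [DecidableEq α] (F S : Finset α) (c : α → α)
    (hc : ∀ i ∈ F, c i ∈ S) (g : α → ℝ) (m : α → ℕ) (hm : ∀ s, 0 < m s) :
    ∃ O ⊆ F, O.card ≤ ∑ s ∈ S, m s ∧ ∃ w : α → α → ℝ, (∀ i i', 0 ≤ w i i') ∧
      (∀ i ∈ F, ∑ i' ∈ O, w i i' = 1) ∧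
      ∀ i ∈ F, ∀ i' ∈ O, w i i' = 0 ∨ (i = i' ∧ w i i' = 1) ∨
        (c i = c i' ∧ g i' ≤ g i ∧ w i i' = 1 / m (c i')) := by
  choose P hPsub hPle hPcard hPmin using
    fun s ↦ exists_subset_card_smallest (F.filter fun i ↦ c i = s) g (m s)
  have hmem : ∀ i, i ∈ S.biUnion P ↔ i ∈ P (c i) := by
    intro i
    rw [Finset.mem_biUnion]
    constructor
    · rintro ⟨s, -, hi⟩
      rwa [(Finset.mem_filter.1 (hPsub s hi)).2]
    · intro hi
      exact ⟨c i, hc i (Finset.mem_filter.1 (hPsub _ hi)).1, hi⟩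
  refine ⟨S.biUnion P, fun i hi ↦ ?_,
    Finset.card_biUnion_le.trans (Finset.sum_le_sum fun s _ ↦ hPle s),
    fun i i' ↦ if i ∈ S.biUnion P then (if i = i' then 1 else 0)
      else if c i' = c i then 1 / m (c i) else 0, fun i i' ↦ ?_, fun i hi ↦ ?_,
    fun i hi i' hi' ↦ ?_⟩
  · exact (Finset.mem_filter.1 (hPsub _ ((hmem i).1 hi))).1
  · dsimp only
    split_ifs <;> positivity
  · by_cases hO : i ∈ S.biUnion P
    · simp only [if_pos hO, Finset.sum_ite_eq]
    · simp only [if_neg hO]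
      have hfil : (S.biUnion P).filter (fun i' ↦ c i' = c i) = P (c i) := by
        ext i'
        rw [Finset.mem_filter, hmem]
        constructor
        · rintro ⟨h, h'⟩
          rwa [← h']
        · intro h
          have h' := (Finset.mem_filter.1 (hPsub _ h)).2
          exact ⟨by rwa [h'], h'⟩
      have hcard : (P (c i)).card = m (c i) := by
        refine (hPcard (c i)).resolve_right fun h ↦ hO ((hmem i).2 ?_)
        rw [h]
        exact Finset.mem_filter.2 ⟨hi, rfl⟩
      rw [← Finset.sum_filter, hfil, Finset.sum_const, hcard, nsmul_eq_mul]
      have : (m (c i) : ℝ) ≠ 0 := Nat.cast_ne_zero.2 (hm _).ne'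
      field_simp
  · by_cases hO : i ∈ S.biUnion P
    · simp only [if_pos hO]
      by_cases h : i = i'
      · exact Or.inr (Or.inl ⟨h, if_pos h⟩)
      · exact Or.inl (if_neg h)
    · simp only [if_neg hO]
      by_cases h : c i' = c i
      · refine Or.inr (Or.inr ⟨h.symm, hPmin (c i) i' ?_ i ?_ ?_, ?_⟩)
        · rw [← h]
          exact (hmem i').1 hi'
        · exact Finset.mem_filter.2 ⟨hi, rfl⟩
        · rwa [← hmem]
        · rw [if_pos h, h]
      · exact Or.inl (if_neg h)

/-- Opening `(1+ε)k` facilities while keeping a fractional assignment of bounded load and range. -/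
theorem SCLPFeasible.exists_open_fractional {X : Type*} [MetricSpace X] [DecidableEq X]
    {F C : Finset X} {T : ℝ} {k : ℕ} {x : X → X → ℝ} {y : X → ℝ} (h : SCLPFeasible F C T k x y)
    (hT : 0 < T) (hC : C.Nonempty) {ε : ℝ} (hε : 0 < ε) (hε1 : ε < 1) :
    ∃ O ⊆ F, (O.card : ℝ) ≤ (1 + ε) * k ∧ ∃ z : X → X → ℝ,
      (∀ i ∈ O, ∀ j ∈ C, 0 ≤ z i j) ∧ (∀ j ∈ C, ∑ i ∈ O, z i j = 1) ∧
      (∀ i ∈ O, ∀ j ∈ C, 0 < z i j → dist i j ≤ 19 * T / ε) ∧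
      ∀ i ∈ O, ∑ j ∈ C, dist i j * z i j ≤ T + 38 * T / ε ^ 2 := by
  obtain ⟨hx, hy, hload, hk, hsum, hxy, hfar⟩ := h
  have hx0 : ∀ i ∈ F, ∀ j ∈ C, 0 ≤ x i j := fun i hi j hj ↦ (hx i hi j hj).1
  have hdT : ∀ i ∈ F, ∀ j ∈ C, 0 < x i j → dist i j ≤ T := fun i hi j hj hpos ↦
    not_lt.1 fun hlt ↦ hpos.ne' (hfar i hi j hj hlt)
  let cost : X → ℝ := fun j ↦ ∑ i ∈ F, dist i j * x i j
  let R : X → ℝ := fun j ↦ cost j / (ε / 4)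
  have hcost0 : ∀ j ∈ C, 0 ≤ cost j := fun j hj ↦
    Finset.sum_nonneg fun i hi ↦ mul_nonneg dist_nonneg (hx0 i hi j hj)
  have hR0 : ∀ j ∈ C, 0 ≤ R j := fun j hj ↦ div_nonneg (hcost0 j hj) (by positivity)
  have hRT : ∀ j ∈ C, R j ≤ 4 * T / ε := by
    intro j hj
    have : cost j ≤ T := by
      calc cost j ≤ ∑ i ∈ F, T * x i j := Finset.sum_le_sum fun i hi ↦ by
            rcases (hx0 i hi j hj).eq_or_lt with h | h
            · simp [← h]
            · exact mul_le_mul_of_nonneg_right (hdT i hi j hj h) h.le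
        _ = T := by rw [← Finset.mul_sum, hsum j hj, mul_one]
    change cost j / (ε / 4) ≤ _
    rw [div_le_div_iff₀ (by positivity) hε]
    nlinarith
  have htotal : ∑ j ∈ C, cost j ≤ T * k := by
    calc ∑ j ∈ C, cost j = ∑ i ∈ F, ∑ j ∈ C, dist i j * x i j := Finset.sum_comm
      _ ≤ ∑ i ∈ F, T * y i := Finset.sum_le_sum hload
      _ ≤ T * k := by rw [← Finset.mul_sum]; exact mul_le_mul_of_nonneg_left hk hT.le
  obtain ⟨S, hSC, hsep, hcov⟩ := exists_separated_centers C R hR0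
  have hS : (S.card : ℝ) ≤ (1 + ε / 2) * k := by
    have h1 : (S.card : ℝ) * (1 - ε / 4) ≤ k := by
      calc (S.card : ℝ) * (1 - ε / 4)
          ≤ ∑ s ∈ S, ∑ i ∈ F with dist i s ≤ R s, y i := by
            rw [← nsmul_eq_mul, ← Finset.sum_const]
            refine Finset.sum_le_sum fun s hs ↦ ?_
            refine (one_sub_le_sum_filter_le F (fun i ↦ x i s) (fun i ↦ dist i s) (ε / 4)
              (by positivity) (fun i hi ↦ hx0 i hi s (hSC hs)) (fun _ _ ↦ dist_nonneg)
              (hsum s (hSC hs))).trans ?_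
            exact Finset.sum_le_sum fun i hi ↦ hxy i (Finset.mem_filter.1 hi).1 s (hSC hs)
        _ = ∑ i ∈ S.biUnion fun s ↦ F.filter fun i ↦ dist i s ≤ R s, y i := by
            refine (Finset.sum_biUnion fun s hs t ht hst ↦ ?_).symm
            refine Finset.disjoint_left.2 fun i his hit ↦ ?_
            have h1 := (Finset.mem_filter.1 his).2
            have h2 := (Finset.mem_filter.1 hit).2
            have h3 := hsep s hs t ht hst
            have h4 := dist_triangle_left s t i
            linarith
        _ ≤ ∑ i ∈ F, y i := Finset.sum_le_sum_of_subset_of_nonneg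
            (Finset.biUnion_subset.2 fun _ _ ↦ Finset.filter_subset _ _)
            fun i hi _ ↦ (hy i hi).1
        _ ≤ k := hk
    have h2 : (1 : ℝ) ≤ (1 - ε / 4) * (1 + ε / 2) := by nlinarith
    have h3 : (0 : ℝ) ≤ S.card := Nat.cast_nonneg _
    nlinarith
  have hSne : S.Nonempty := by
    obtain ⟨j, hj⟩ := hC
    obtain ⟨s, hs, -⟩ := hcov j hj
    exact ⟨s, hs⟩
  choose c hcS hcmin using fun i : X ↦ Finset.exists_min_image S (fun s ↦ dist i s) hSne
  have hnear : ∀ i, ∀ j ∈ C, dist i (c i) ≤ dist i j + 2 * R j := by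
    intro i j hj
    obtain ⟨s, hs, hsR, hds⟩ := hcov j hj
    linarith [hcmin i s hs, dist_triangle i j s]
  have hmove : ∀ i i', ∀ j ∈ C, c i = c i' → dist i' (c i') ≤ dist i (c i) →
      dist i' j ≤ 3 * dist i j + 4 * R j := by
    intro i i' j hj hcc hle
    rw [← hcc] at hle
    have h1 := dist_triangle4 i' (c i) i j
    rw [dist_comm (c i) i] at h1
    linarith [hnear i j hj]
  let B : X → ℝ := fun i ↦ ∑ j ∈ C, (3 * dist i j + 4 * R j) * x i j
  let A : X → ℝ := fun s ↦ ∑ i ∈ F with c i = s, B i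
  have hB0 : ∀ i ∈ F, 0 ≤ B i := fun i hi ↦ Finset.sum_nonneg fun j hj ↦
    mul_nonneg (by linarith [hR0 j hj, dist_nonneg (x := i) (y := j)]) (hx0 i hi j hj)
  have hA0 : ∀ s, 0 ≤ A s := fun s ↦
    Finset.sum_nonneg fun i hi ↦ hB0 i (Finset.mem_filter.1 hi).1
  have hAtotal : ∑ s ∈ S, A s ≤ 19 / ε * (T * k) := by
    calc ∑ s ∈ S, A s = ∑ i ∈ F, B i := Finset.sum_fiberwise_of_maps_to (fun i _ ↦ hcS i) _
      _ = ∑ j ∈ C, (3 * cost j + 4 * R j * ∑ i ∈ F, x i j) := by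
          rw [Finset.sum_comm]
          refine Finset.sum_congr rfl fun j _ ↦ ?_
          rw [Finset.mul_sum, Finset.mul_sum, ← Finset.sum_add_distrib]
          exact Finset.sum_congr rfl fun i _ ↦ by ring
      _ = (3 + 16 / ε) * ∑ j ∈ C, cost j := by
          rw [Finset.mul_sum]
          refine Finset.sum_congr rfl fun j hj ↦ ?_
          rw [hsum j hj]
          change 3 * cost j + 4 * (cost j / (ε / 4)) * 1 = _
          field_simp
          ring
      _ ≤ 19 / ε * ∑ j ∈ C, cost j := by
          refine mul_le_mul_of_nonneg_right ?_ (Finset.sum_nonneg hcost0)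
          rw [le_div_iff₀ hε, add_mul, div_mul_cancel₀ _ hε.ne']
          linarith
      _ ≤ 19 / ε * (T * k) := mul_le_mul_of_nonneg_left htotal (by positivity)
  set Λ : ℝ := 38 * T / ε ^ 2 with hΛ
  have hΛ0 : 0 < Λ := by positivity
  obtain ⟨O, hOF, hOcard, w, hw0, hw1, hw⟩ := exists_open_and_transport F S c (fun i _ ↦ hcS i)
    (fun i ↦ dist i (c i)) (fun s ↦ ⌊A s / Λ⌋₊ + 1) fun s ↦ Nat.succ_pos _
  refine ⟨O, hOF, ?_, fun i' j ↦ ∑ i ∈ F, w i i' * x i j, fun i' _ j hj ↦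
    Finset.sum_nonneg fun i hi ↦ mul_nonneg (hw0 _ _) (hx0 i hi j hj), fun j hj ↦ ?_,
    fun i' hi' j hj hpos ↦ ?_, fun i' hi' ↦ ?_⟩
  · have h1 : (O.card : ℝ) ≤ ∑ s ∈ S, (A s / Λ + 1) := by
      refine (Nat.cast_le.2 hOcard).trans ?_
      push_cast
      exact Finset.sum_le_sum fun s _ ↦
        add_le_add_left (Nat.floor_le (div_nonneg (hA0 s) hΛ0.le)) 1
    rw [Finset.sum_add_distrib, ← Finset.sum_div, Finset.sum_const, nsmul_eq_mul, mul_one] at h1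
    have h2 : (∑ s ∈ S, A s) / Λ ≤ ε / 2 * k := by
      rw [div_le_iff₀ hΛ0]
      refine hAtotal.trans_eq ?_
      rw [hΛ]
      field_simp
      ring
    linarith
  · rw [Finset.sum_comm, ← hsum j hj]
    exact Finset.sum_congr rfl fun i hi ↦ by rw [← Finset.sum_mul, hw1 i hi, one_mul]
  · obtain ⟨i, hi, hne⟩ := Finset.exists_ne_zero_of_sum_ne_zero hpos.ne'
    have hxpos : 0 < x i j := (hx0 i hi j hj).lt_of_ne' (right_ne_zero_of_mul hne)
    have hd := hdT i hi j hj hxpos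
    have hTε : T ≤ T / ε := by rw [le_div_iff₀ hε]; nlinarith
    have hRj := hRT j hj
    rw [mul_div_assoc] at hRj ⊢
    rcases hw i hi i' hi' with h0 | ⟨rfl, -⟩ | ⟨hcc, hg, -⟩
    · exact absurd h0 (left_ne_zero_of_mul hne)
    · linarith
    · linarith [hmove i i' j hj hcc hg]
  · calc ∑ j ∈ C, dist i' j * ∑ i ∈ F, w i i' * x i j
        = ∑ i ∈ F, w i i' * ∑ j ∈ C, dist i' j * x i j := by
          simp only [Finset.mul_sum]
          rw [Finset.sum_comm]
          exact Finset.sum_congr rfl fun i _ ↦ Finset.sum_congr rfl fun j _ ↦ by ring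
      _ ≤ ∑ i ∈ F, ((if i = i' then T else 0) +
            if c i = c i' then 1 / ((⌊A (c i') / Λ⌋₊ + 1 : ℕ) : ℝ) * B i else 0) := by
          refine Finset.sum_le_sum fun i hi ↦ ?_
          have hsnd : 0 ≤ if c i = c i' then
              1 / ((⌊A (c i') / Λ⌋₊ + 1 : ℕ) : ℝ) * B i else 0 := by
            split_ifs
            · exact mul_nonneg (by positivity) (hB0 i hi)
            · exact le_rfl
          have hfst : 0 ≤ if i = i' then T else 0 := by split_ifs <;> linarith
          rcases hw i hi i' hi' with h0 | ⟨rfl, h1⟩ | ⟨hcc, hg, hwm⟩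
          · rw [h0, zero_mul]
            exact add_nonneg hfst hsnd
          · rw [h1, one_mul, if_pos rfl]
            have := hload i hi
            nlinarith [(hy i hi).2]
          · refine le_add_of_nonneg_of_le hfst ?_
            rw [if_pos hcc, hwm]
            refine mul_le_mul_of_nonneg_left (Finset.sum_le_sum fun j hj ↦ ?_) (by positivity)
            exact mul_le_mul_of_nonneg_right (hmove i i' j hj hcc hg) (hx0 i hi j hj)
      _ = T + 1 / ((⌊A (c i') / Λ⌋₊ + 1 : ℕ) : ℝ) * A (c i') := by
          rw [Finset.sum_add_distrib, Finset.sum_ite_eq', if_pos (hOF hi'), ← Finset.sum_filter,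
            ← Finset.mul_sum]
      _ ≤ T + Λ := by
          have hlt := Nat.lt_floor_add_one (A (c i') / Λ)
          rw [div_lt_iff₀ hΛ0] at hlt
          rw [one_div_mul_eq_div]
          gcongr
          rw [div_le_iff₀ (by positivity)]
          push_cast
          linarith

/-- Rounding of SC-LP with `(1+ε)k` opened facilities and `O(1/ε²)·T` loads
(Theorem 3 / `scload` of the paper, combined with makespan rounding). -/
theorem sclp_rounding_load :
    ∃ c : ℝ, 0 < c ∧
      ∀ (X : Type) [MetricSpace X] (F C : Finset X), Disjoint F C →
        ∀ (T : ℝ), 0 < T → ∀ (k : ℕ) (x : X → X → ℝ) (y : X → ℝ),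
          SCLPFeasible F C T k x y →
            ∀ ε : ℝ, 0 < ε → ε < 1 →
              ∃ (xh : X → X → ℝ) (yh : X → ℝ),
                (∀ i ∈ F, ∀ j ∈ C, xh i j = 0 ∨ xh i j = 1) ∧
                (∀ i ∈ F, yh i = 0 ∨ yh i = 1) ∧
                (∀ j ∈ C, ∑ i ∈ F, xh i j = 1) ∧
                (∀ i ∈ F, ∀ j ∈ C, xh i j ≤ yh i) ∧
                (∑ i ∈ F, yh i ≤ (1 + ε) * k) ∧
                (∀ i ∈ F, ∑ j ∈ C, dist i j * xh i j ≤ (c / ε ^ 2) * T * yh i) := by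
  classical
  refine ⟨192, by norm_num, ?_⟩
  intro X _ F C _ T hT k x y h ε hε hε1
  rcases C.eq_empty_or_nonempty with rfl | hC
  · exact ⟨fun _ _ ↦ 0, fun _ ↦ 0, by simp, by simp, by simp, by simp, by
      rw [Finset.sum_const_zero]; positivity, by simp⟩
  obtain ⟨O, hOF, hOcard, z, hz0, hz1, hzd, hzload⟩ := h.exists_open_fractional hT hC hε hε1
  obtain ⟨σ, hσ, hload⟩ := exists_assignment_load_le O C z dist (19 * T / ε) hz0 hz1
    (fun _ _ _ _ ↦ dist_nonneg) (by positivity) hzd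
  have hsumO : ∀ i, ∀ j : C, (if σ j = i then (1 : ℝ) else 0) ≤ if i ∈ O then 1 else 0 := by
    intro i j
    by_cases hij : σ j = i
    · rw [if_pos hij, if_pos (hij ▸ (hσ j).1)]
    · rw [if_neg hij]
      split_ifs <;> norm_num
  refine ⟨fun i j ↦ if hj : j ∈ C then (if σ ⟨j, hj⟩ = i then 1 else 0) else 0,
    fun i ↦ if i ∈ O then 1 else 0, fun i _ j hj ↦ ?_, fun i _ ↦ ?_, fun j hj ↦ ?_,
    fun i _ j hj ↦ ?_, ?_, fun i hi ↦ ?_⟩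
  · simp only [dif_pos hj]
    split_ifs <;> simp
  · dsimp only
    split_ifs <;> simp
  · simp only [dif_pos hj]
    rw [Finset.sum_ite_eq, if_pos (hOF (hσ _).1)]
  · simp only [dif_pos hj]
    exact hsumO i ⟨j, hj⟩
  · rw [← Finset.sum_filter, Finset.filter_mem_eq_inter, Finset.inter_eq_right.2 hOF]
    simpa using hOcard
  · have hsplit : ∑ j ∈ C, dist i j * (if hj : j ∈ C then (if σ ⟨j, hj⟩ = i then 1 else 0) else 0)
        = ∑ j : C with σ j = i, dist i (j : X) := by
      rw [← Finset.sum_coe_sort, Finset.sum_filter]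
      exact Finset.sum_congr rfl fun j _ ↦ by simp
    rw [hsplit]
    dsimp only
    by_cases hiO : i ∈ O
    · rw [if_pos hiO, mul_one]
      refine (hload i hiO).trans ?_
      have h1 := hzload i hiO
      have h2 : T ≤ T / ε ^ 2 := by
        rw [le_div_iff₀ (by positivity)]
        nlinarith [mul_pos hT hε]
      have h3 : T / ε ≤ T / ε ^ 2 := by
        gcongr
        nlinarith
      rw [mul_div_assoc] at h1 ⊢
      rw [div_mul_eq_mul_div, mul_div_assoc]
      linarith
    · rw [if_neg hiO, mul_zero]
      refine (Finset.sum_eq_zero fun j hj ↦ absurd ?_ hiO).le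
      exact (Finset.mem_filter.1 hj).2 ▸ (hσ j).1
end

section
/- There exists an absolute constant c > 0 such that the following holds. Let F, C be disjoint finite sets with a metric d on F ∪ C, let T > 0 and k ∈ ℕ, and let (x, y) be a feasible solution to SC-LP(T, k). Then for every ε ∈ (0, 1) there exist integral functions x̂ : F × C → {0, 1} and ŷ : F → {0, 1} such that ∑_{i ∈ F} x̂_{ij} = 1 for every j ∈ C, x̂_{ij} ≤ ŷ_i for all i, j, ∑_{i ∈ F} ŷ_i ≤ (c/ε²)·k, and L(i, x̂) ≤ (2 + ε)·T·ŷ_i for every i ∈ F. -/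
open Finset in
/-- A fractional assignment that saturates every left vertex and overloads no right vertex
contains a matching saturating the left side. -/
theorem exists_injective_of_fractional_matching {α β : Type*} (J : Finset α) (K : Finset β)
    (w : α → β → ℝ) (hw : ∀ j ∈ J, ∀ b ∈ K, 0 ≤ w j b) (hJ : ∀ j ∈ J, 1 ≤ ∑ b ∈ K, w j b)
    (hK : ∀ b ∈ K, ∑ j ∈ J, w j b ≤ 1) :
    ∃ f : J → β, Function.Injective f ∧ ∀ j : J, f j ∈ K ∧ 0 < w j (f j) := by
  classical
  let t : J → Finset β := fun j => {b ∈ K | 0 < w j b}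
  obtain ⟨f, hf, hft⟩ := (all_card_le_biUnion_card_iff_exists_injective t).1 fun s => by
    have hsub : s.biUnion t ⊆ K := fun b hb => by
      obtain ⟨j, -, hj⟩ := mem_biUnion.1 hb
      exact (mem_filter.1 hj).1
    have key : (#s : ℝ) ≤ #(s.biUnion t) := by
      calc (#s : ℝ) = ∑ j ∈ s, (1 : ℝ) := by simp
        _ ≤ ∑ j ∈ s, ∑ b ∈ s.biUnion t, w j b := by
          refine sum_le_sum fun j hj => (hJ j j.2).trans (le_of_eq ?_)
          refine (sum_subset hsub fun b hb hb' => ?_).symm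
          by_contra hne
          exact hb' (mem_biUnion.2 ⟨j, hj, mem_filter.2
            ⟨hb, lt_of_le_of_ne (hw j j.2 b hb) (Ne.symm hne)⟩⟩)
        _ = ∑ b ∈ s.biUnion t, ∑ j ∈ s, w j b := sum_comm
        _ ≤ ∑ b ∈ s.biUnion t, (1 : ℝ) := by
          refine sum_le_sum fun b hb => le_trans ?_ (hK b (hsub hb))
          rw [← sum_coe_sort J]
          exact sum_le_sum_of_subset_of_nonneg (subset_univ s)
            fun j _ _ => hw j j.2 b (hsub hb)
        _ = #(s.biUnion t) := by simp
    exact_mod_cast key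
  exact ⟨f, hf, fun j => mem_filter.1 (hft j)⟩

/-- The lengths of the intersections of `[0, t]` with the unit intervals `[s, s + 1]`
add up to `min t N`. -/
theorem sum_range_clamp (N : ℕ) (t : ℝ) (h0 : 0 ≤ t) :
    ∑ s ∈ Finset.range N, min (max (t - s) 0) 1 = min t N := by
  induction N with
  | zero => simp [h0]
  | succ n ih =>
    rw [Finset.sum_range_succ, ih]
    push_cast
    rcases le_total t n with h | h
    · rw [min_eq_left h, max_eq_right (by linarith), min_eq_left (by linarith),
        min_eq_left (by linarith), add_zero]
    · rw [min_eq_right h, max_eq_left (by linarith)]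
      rcases le_total t (n + 1) with h' | h'
      · rw [min_eq_left (by linarith), min_eq_left h']; ring
      · rw [min_eq_right (by linarith), min_eq_right h']

/-- Splitting the fractional assignment `z` to one machine into unit slots,
in order of decreasing cost `p`. -/
theorem exists_slots {α : Type*} (p z : α → ℝ) (N : ℕ) (U : Finset α)
    (hp : ∀ j ∈ U, 0 ≤ p j) (hz : ∀ j ∈ U, 0 ≤ z j) (hN : ∑ j ∈ U, z j ≤ N) :
    ∃ w : α → ℕ → ℝ, (∀ j ∈ U, ∀ s, 0 ≤ w j s) ∧
      (∀ j ∈ U, ∑ s ∈ Finset.range N, w j s = z j) ∧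
      (∀ s, ∑ j ∈ U, w j s = min (max ((∑ j ∈ U, z j) - s) 0) 1) ∧
      (∀ a ∈ U, ∀ s, 0 < w a (s + 1) → p a ≤ ∑ j ∈ U, p j * w j s) := by
  classical
  induction U using Finset.induction_on_min_value p with
  | empty => exact ⟨0, by simp⟩
  | insert a U haU hmin ih =>
    simp only [Finset.forall_mem_insert] at hp hz
    rw [Finset.sum_insert haU] at hN
    obtain ⟨w, hw0, hwz, hws, hwp⟩ := ih hp.2 hz.2 (by linarith)
    set Z := ∑ j ∈ U, z j with hZ
    have hZ0 : 0 ≤ Z := Finset.sum_nonneg hz.2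
    let v : ℕ → ℝ := fun s => min (max (z a + Z - s) 0) 1 - min (max (Z - s) 0) 1
    have hv0 : ∀ s, 0 ≤ v s := fun s => sub_nonneg.2
      (min_le_min_right _ (max_le_max_right _ (by linarith)))
    have hU : ∀ j ∈ U, Function.update w a v j = w j := fun j hj =>
      Function.update_of_ne (ne_of_mem_of_not_mem hj haU) _ _
    have hsumU : ∀ (g : α → ℝ) s, ∑ j ∈ U, g j * Function.update w a v j s
        = ∑ j ∈ U, g j * w j s := fun g s =>
      Finset.sum_congr rfl fun j hj => by rw [hU j hj]
    have hsum : ∀ s, ∑ j ∈ insert a U, Function.update w a v j s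
        = min (max (z a + Z - s) 0) 1 := fun s => by
      have := hsumU 1 s
      simp only [Pi.one_apply, one_mul] at this
      rw [Finset.sum_insert haU, this, hws, Function.update_self]
      ring
    refine ⟨Function.update w a v, ?_, ?_, ?_, ?_⟩
    · rw [Finset.forall_mem_insert]
      exact ⟨by simpa using hv0, fun j hj => by rw [hU j hj]; exact hw0 j hj⟩
    · rw [Finset.forall_mem_insert]
      refine ⟨?_, fun j hj => by rw [hU j hj]; exact hwz j hj⟩
      simp only [Function.update_self, v]
      rw [Finset.sum_sub_distrib, sum_range_clamp _ _ (by linarith [hz.1]),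
        sum_range_clamp _ _ hZ0, min_eq_left hN, min_eq_left (by linarith [hz.1])]
      ring
    · intro s
      rw [hsum, Finset.sum_insert haU]
    · rw [Finset.forall_mem_insert]
      constructor
      · intro s hs
        have hfull : ∑ j ∈ insert a U, Function.update w a v j s = 1 := by
          rw [hsum, min_eq_right]
          by_contra hlt
          have h1 : z a + Z - s < 1 := (le_max_left _ _).trans_lt (not_le.1 hlt)
          have h2 : v (s + 1) = 0 := by
            simp only [v]
            push_cast
            rw [max_eq_right (by linarith), max_eq_right (by linarith [hz.1])]
            simp
          rw [Function.update_self, h2] at hs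
          exact lt_irrefl _ hs
        calc p a = ∑ j ∈ insert a U, p a * Function.update w a v j s := by
              rw [← Finset.mul_sum, hfull, mul_one]
          _ ≤ ∑ j ∈ insert a U, p j * Function.update w a v j s := by
              refine Finset.sum_le_sum (Finset.forall_mem_insert _ _ _ |>.2
                ⟨le_rfl, fun j hj => ?_⟩)
              rw [hU j hj]
              exact mul_le_mul_of_nonneg_right (hmin j hj) (hw0 j hj s)
      · intro j hj s hs
        rw [hU j hj] at hs
        rw [Finset.sum_insert haU, hsumU, Function.update_self]
        linarith [hwp j hj s hs, mul_nonneg hp.1 (hv0 s)]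

open Finset in
/-- Shmoys–Tardos makespan rounding. -/
theorem exists_integral_assignment {α β : Type*} [DecidableEq β] (O : Finset β) (C : Finset α)
    (p z : β → α → ℝ) (L T : ℝ) (hT : 0 ≤ T) (hp : ∀ i ∈ O, ∀ j ∈ C, 0 ≤ p i j)
    (hz : ∀ i ∈ O, ∀ j ∈ C, 0 ≤ z i j) (hC : ∀ j ∈ C, 1 ≤ ∑ i ∈ O, z i j)
    (hpT : ∀ i ∈ O, ∀ j ∈ C, 0 < z i j → p i j ≤ T)
    (hL : ∀ i ∈ O, ∑ j ∈ C, p i j * z i j ≤ L) :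
    ∃ f : C → β, (∀ j, f j ∈ O) ∧
      ∀ i ∈ O, ∑ j : C with f j = i, p i j ≤ L + T := by
  classical
  obtain ⟨N, hN⟩ := exists_nat_ge (∑ i ∈ O, ∑ j ∈ C, z i j)
  have hNi : ∀ i ∈ O, ∑ j ∈ C, z i j ≤ N := fun i hi =>
    (single_le_sum (f := fun i => ∑ j ∈ C, z i j)
      (fun i hi => sum_nonneg (hz i hi)) hi).trans hN
  choose! w hw0 hwz hws hwp using fun i (hi : i ∈ O) =>
    exists_slots (p i) (z i) N C (hp i hi) (hz i hi) (hNi i hi)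
  obtain ⟨g, hg, hgw⟩ := exists_injective_of_fractional_matching C (O ×ˢ range N)
    (fun j b => w b.1 j b.2) (fun j hj b hb => hw0 _ (mem_product.1 hb).1 j hj _)
    (fun j hj => by
      rw [sum_product]
      exact (hC j hj).trans (le_of_eq (sum_congr rfl fun i hi => (hwz i hi j hj).symm)))
    (fun b hb => by
      rw [hws _ (mem_product.1 hb).1]
      exact min_le_right _ _)
  have hgO : ∀ j, (g j).1 ∈ O := fun j => (mem_product.1 (hgw j).1).1
  have hgN : ∀ j, (g j).2 < N := fun j => mem_range.1 (mem_product.1 (hgw j).1).2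
  refine ⟨fun j => (g j).1, hgO, fun i hi => ?_⟩
  have hle : ∀ j : C, (g j).1 = i →
      p i j ≤ if (g j).2 = 0 then T else ∑ a ∈ C, p i a * w i a ((g j).2 - 1) := by
    rintro j rfl
    have hpos := (hgw j).2
    split_ifs with h0
    · refine hpT _ hi j j.2 (hpos.trans_le ?_)
      rw [← hwz _ hi j j.2]
      exact single_le_sum (fun s _ => hw0 _ hi j j.2 s) (mem_range.2 (hgN j))
    · obtain ⟨s, hs⟩ := Nat.exists_eq_succ_of_ne_zero h0
      rw [hs] at hpos ⊢
      exact hwp _ hi j j.2 s hpos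
  let Q : ℕ → ℝ := fun s => if s = 0 then T else ∑ a ∈ C, p i a * w i a (s - 1)
  have hQ : ∀ s, 0 ≤ Q s := fun s => by
    simp only [Q]
    split_ifs
    · exact hT
    · exact sum_nonneg fun a ha => mul_nonneg (hp i hi a ha) (hw0 i hi a ha _)
  calc ∑ j : C with (g j).1 = i, p i j
      ≤ ∑ j : C with (g j).1 = i, Q (g j).2 :=
        sum_le_sum fun j hj => hle j (mem_filter.1 hj).2
    _ = ∑ s ∈ ({j : C | (g j).1 = i} : Finset C).image (fun j => (g j).2), Q s := by
        rw [sum_image]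
        intro a ha b hb hab
        have h1 : (g a).1 = i := by simpa using ha
        have h2 : (g b).1 = i := by simpa using hb
        exact hg (Prod.ext (h1.trans h2.symm) hab)
    _ ≤ ∑ s ∈ range (N + 1), Q s := by
        refine sum_le_sum_of_subset_of_nonneg (fun s hs => ?_) fun s _ _ => hQ s
        obtain ⟨j, -, rfl⟩ := mem_image.1 hs
        exact mem_range.2 ((hgN j).trans (Nat.lt_succ_self N))
    _ = ∑ a ∈ C, p i a * z i a + T := by
        rw [sum_range_succ']
        simp only [Q, Nat.add_eq_zero_iff, one_ne_zero, and_false, if_false, if_true,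
          Nat.add_sub_cancel]
        rw [sum_comm]
        refine congrArg (· + T) (sum_congr rfl fun a ha => ?_)
        rw [← mul_sum, hwz i hi a ha]
    _ ≤ L + T := by linarith [hL i hi]

open Finset in
/-- Grouping the points of `U` into clusters of weight at most `M` around nearby centers, so that
the centers of any two underfull clusters are far apart. -/
theorem exists_capacitated_clustering {X : Type*} [PseudoMetricSpace X] [DecidableEq X]
    (y ρ : X → ℝ) (M : ℝ) (U : Finset X) (hρ : ∀ i ∈ U, 0 ≤ ρ i) (hy0 : ∀ i ∈ U, 0 ≤ y i)
    (hyM : ∀ i ∈ U, y i ≤ M / 2) :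
    ∃ π : X → X, (∀ i ∈ U, π i ∈ U) ∧ (∀ i ∈ U, dist i (π i) ≤ 2 * ρ i) ∧
      (∀ s ∈ U, ∑ i ∈ U with π i = s, y i ≤ M) ∧
      (∀ s ∈ U.image π, ∀ t ∈ U.image π, s ≠ t → ∑ i ∈ U with π i = s, y i < M / 2 →
        ∑ i ∈ U with π i = t, y i < M / 2 → ρ s + ρ t < dist s t) := by
  induction U using Finset.induction_on_max_value ρ with
  | empty => exact ⟨id, by simp⟩
  | insert a U haU hmax ih =>
    simp only [forall_mem_insert] at hρ hy0 hyM
    obtain ⟨π, hπ, hdist, hmass, hsep⟩ := ih hρ.2 hy0.2 hyM.2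
    have himU : ∀ s ∈ U.image π, s ∈ U := fun s hs => by
      obtain ⟨i, hi, rfl⟩ := mem_image.1 hs
      exact hπ i hi
    have hupd : ∀ b, ∀ i ∈ U, Function.update π a b i = π i := fun b i hi =>
      Function.update_of_ne (ne_of_mem_of_not_mem hi haU) _ _
    have himage : ∀ b, (insert a U).image (Function.update π a b) = insert b (U.image π) :=
      fun b => by
        rw [image_insert, Function.update_self]
        exact congrArg _ (image_congr fun i hi => hupd b i hi)
    have hfil : ∀ b s, ∑ i ∈ insert a U with Function.update π a b i = s, y i
        = (if b = s then y a else 0) + ∑ i ∈ U with π i = s, y i := fun b s => by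
      rw [sum_filter, sum_insert haU, Function.update_self, sum_filter]
      exact congrArg _ (sum_congr rfl fun i hi => by rw [hupd b i hi])
    have hmass_a : ∑ i ∈ U with π i = a, y i = 0 := by
      rw [filter_false_of_mem (p := fun i => π i = a) fun i hi h => haU (h ▸ hπ i hi),
      sum_empty]
    have hmono : ∀ b s, ∑ i ∈ U with π i = s, y i
        ≤ ∑ i ∈ insert a U with Function.update π a b i = s, y i := fun b s => by
      rw [hfil]
      split_ifs <;> linarith [hy0.1]
    by_cases hjoin : ∃ b ∈ U.image π, ∑ i ∈ U with π i = b, y i < M / 2 ∧ dist a b ≤ ρ a + ρ b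
    · obtain ⟨b, hb, hbM, hab⟩ := hjoin
      refine ⟨Function.update π a b, ?_, ?_, ?_, ?_⟩
      · rw [forall_mem_insert, Function.update_self]
        exact ⟨mem_insert_of_mem (himU b hb), fun i hi => by
          rw [hupd b i hi]; exact mem_insert_of_mem (hπ i hi)⟩
      · rw [forall_mem_insert, Function.update_self]
        exact ⟨by linarith [hmax b (himU b hb)], fun i hi => by
          rw [hupd b i hi]; exact hdist i hi⟩
      · intro s hs
        rw [hfil]
        split_ifs with h
        · subst h
          linarith [hyM.1]
        · rcases mem_insert.1 hs with rfl | hs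
          · linarith [hy0.1, hyM.1]
          · linarith [hmass s hs]
      · rw [himage, insert_eq_of_mem hb]
        exact fun s hs t ht hst hsM htM => hsep s hs t ht hst
          ((hmono b s).trans_lt hsM) ((hmono b t).trans_lt htM)
    · push Not at hjoin
      refine ⟨Function.update π a a, ?_, ?_, ?_, ?_⟩
      · rw [forall_mem_insert, Function.update_self]
        exact ⟨mem_insert_self _ _, fun i hi => by
          rw [hupd a i hi]; exact mem_insert_of_mem (hπ i hi)⟩
      · rw [forall_mem_insert, Function.update_self, dist_self]
        exact ⟨by linarith [hρ.1], fun i hi => by rw [hupd a i hi]; exact hdist i hi⟩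
      · intro s hs
        rw [hfil]
        rcases mem_insert.1 hs with rfl | hs
        · rw [if_pos rfl, hmass_a]
          linarith [hy0.1, hyM.1]
        · rw [if_neg (ne_of_mem_of_not_mem hs haU).symm]
          linarith [hmass s hs]
      · rw [himage]
        intro s hs t ht hst hsM htM
        replace hsM := (hmono a s).trans_lt hsM
        replace htM := (hmono a t).trans_lt htM
        rcases mem_insert.1 hs with rfl | hs' <;> rcases mem_insert.1 ht with rfl | ht'
        · exact absurd rfl hst
        · exact hjoin t ht' htM
        · rw [dist_comm, add_comm]
          exact hjoin s hs' hsM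
        · exact hsep s hs' t ht' hst hsM htM

open Finset in
/-- The number of clusters in `exists_capacitated_clustering` is small
if every point of `U` has weight at least `q` around it. -/
theorem exists_small_capacitated_clustering {X : Type*} [PseudoMetricSpace X] [DecidableEq X]
    (y ρ : X → ℝ) (M q : ℝ) (hM : 0 < M) (hq : 0 < q) (U V : Finset X) (hUV : U ⊆ V)
    (hρ : ∀ i ∈ U, 0 ≤ ρ i) (hy0 : ∀ i ∈ V, 0 ≤ y i) (hyM : ∀ i ∈ U, y i ≤ M / 2)
    (hball : ∀ i ∈ U, q ≤ ∑ a ∈ V with dist i a ≤ ρ i, y a) :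
    ∃ π : X → X, (∀ i ∈ U, π i ∈ U) ∧ (∀ i ∈ U, dist i (π i) ≤ 2 * ρ i) ∧
      (∀ s ∈ U, ∑ i ∈ U with π i = s, y i ≤ M) ∧
      (#(U.image π) : ℝ) ≤ (2 / M + 1 / q) * ∑ i ∈ V, y i := by
  obtain ⟨π, hπ, hdist, hmass, hsep⟩ :=
    exists_capacitated_clustering y ρ M U hρ (fun i hi => hy0 i (hUV hi)) hyM
  refine ⟨π, hπ, hdist, hmass, ?_⟩
  set S := U.image π
  let m : X → ℝ := fun s => ∑ i ∈ U with π i = s, y i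
  have hm0 : ∀ s, 0 ≤ m s := fun s =>
    sum_nonneg fun i hi => hy0 i (hUV (mem_filter.1 hi).1)
  have hSU : ∀ s ∈ S, s ∈ U := fun s hs => by
    obtain ⟨i, hi, rfl⟩ := mem_image.1 hs
    exact hπ i hi
  have hlow : (#{s ∈ S | m s < M / 2} : ℝ) * q ≤ ∑ i ∈ V, y i := by
    calc (#{s ∈ S | m s < M / 2} : ℝ) * q = ∑ s ∈ S with m s < M / 2, q := by simp
      _ ≤ ∑ s ∈ S with m s < M / 2, ∑ a ∈ V with dist s a ≤ ρ s, y a :=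
        sum_le_sum fun s hs => hball s (hSU s (mem_filter.1 hs).1)
      _ = ∑ a ∈ {s ∈ S | m s < M / 2}.biUnion fun s => {a ∈ V | dist s a ≤ ρ s}, y a := by
        refine (sum_biUnion fun s hs t ht hst => ?_).symm
        obtain ⟨hsS, hsm⟩ := mem_filter.1 hs
        obtain ⟨htS, htm⟩ := mem_filter.1 ht
        refine disjoint_left.2 fun a ha hb => ?_
        have h1 := hsep s hsS t htS hst hsm htm
        have h2 := (mem_filter.1 ha).2
        have h3 := (mem_filter.1 hb).2
        linarith [dist_triangle_right s t a]
      _ ≤ ∑ i ∈ V, y i := by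
        refine sum_le_sum_of_subset_of_nonneg ?_ fun i hi _ => hy0 i hi
        exact biUnion_subset.2 fun s _ => filter_subset _ _
  have hhigh : (#{s ∈ S | ¬ m s < M / 2} : ℝ) * (M / 2) ≤ ∑ i ∈ V, y i := by
    calc (#{s ∈ S | ¬ m s < M / 2} : ℝ) * (M / 2)
        = ∑ s ∈ S with ¬ m s < M / 2, M / 2 := by simp
      _ ≤ ∑ s ∈ S with ¬ m s < M / 2, m s :=
        sum_le_sum fun s hs => not_lt.1 (mem_filter.1 hs).2
      _ ≤ ∑ s ∈ S, m s :=
        sum_le_sum_of_subset_of_nonneg (filter_subset _ _) fun s _ _ => hm0 s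
      _ = ∑ i ∈ U, y i := sum_fiberwise_of_maps_to (fun i hi => mem_image_of_mem π hi) y
      _ ≤ ∑ i ∈ V, y i := sum_le_sum_of_subset_of_nonneg hUV fun i hi _ => hy0 i hi
  have hcard : (#S : ℝ) = #{s ∈ S | m s < M / 2} + #{s ∈ S | ¬ m s < M / 2} := by
    exact_mod_cast (card_filter_add_card_filter_not (s := S) (fun s => m s < M / 2)).symm
  rw [hcard, add_mul, add_comm]
  refine add_le_add ?_ ?_
  · rw [div_mul_eq_mul_div, le_div_iff₀ hM]
    linarith
  · rw [div_mul_eq_mul_div, le_div_iff₀ hq]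
    linarith

open Finset in
/-- The elements of `N` that lie weakly above the weighted median of `r` carry
at least half of the weight. -/
theorem half_le_sum_upper_half {α : Type*} (N : Finset α) (r w : α → ℝ)
    (hw : ∀ i ∈ N, 0 ≤ w i) :
    (∑ i ∈ N, w i) / 2
      ≤ ∑ i ∈ N with (∑ a ∈ N, w a) / 2 ≤ ∑ a ∈ N with r a ≤ r i, w a, w i := by
  classical
  set m := ∑ i ∈ N, w i with hm
  have hm0 : 0 ≤ m := sum_nonneg hw
  let P : α → Prop := fun i => m / 2 ≤ ∑ a ∈ N with r a ≤ r i, w a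
  have hsplit : ∑ i ∈ N with P i, w i + ∑ i ∈ N with ¬ P i, w i = m :=
    sum_filter_add_sum_filter_not N P w
  suffices h : ∑ i ∈ N with ¬ P i, w i ≤ m / 2 by
    change m / 2 ≤ ∑ i ∈ N with P i, w i
    linarith
  rcases ({i ∈ N | ¬ P i} : Finset α).eq_empty_or_nonempty with he | hne
  · rw [he, sum_empty]
    linarith
  · obtain ⟨b, hb, hmax⟩ := exists_max_image _ r hne
    refine le_trans ?_ (not_le.1 (mem_filter.1 hb).2).le
    refine sum_le_sum_of_subset_of_nonneg (fun i hi => ?_)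
      fun i hi _ => hw i (mem_filter.1 hi).1
    exact mem_filter.2 ⟨(mem_filter.1 hi).1, hmax i hi⟩

open Finset in
/-- Clients receiving a constant fraction of their service from facilities in `V`
at distance more than `T / 5` can be matched to facilities in `V`. -/
theorem exists_matching_of_far {X : Type*} [PseudoMetricSpace X] (V B : Finset X)
    (x : X → X → ℝ) (y : X → ℝ) (T δ : ℝ) (hT : 0 < T) (hδ : 0 < δ)
    (hx : ∀ i ∈ V, ∀ j ∈ B, 0 ≤ x i j) (hyδ : ∀ i ∈ V, y i ≤ δ / 5)
    (hload : ∀ i ∈ V, ∑ j ∈ B, dist i j * x i j ≤ T * y i)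
    (hB : ∀ j ∈ B, δ ≤ ∑ i ∈ V with ¬ dist i j ≤ T / 5, x i j) :
    ∃ m : X → X, Set.InjOn m B ∧ (∀ j ∈ B, m j ∈ V ∧ 0 < x (m j) j) ∧
      (#B : ℝ) ≤ 5 / δ * ∑ i ∈ V, y i := by
  classical
  let w : X → X → ℝ := fun j i => if ¬ dist i j ≤ T / 5 then x i j / δ else 0
  have hw : ∀ j ∈ B, ∀ i ∈ V, 0 ≤ w j i := fun j hj i hi => by
    simp only [w]
    split_ifs
    · exact le_rfl
    · exact div_nonneg (hx i hi j hj) hδ.le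
  have hwB : ∀ j ∈ B, 1 ≤ ∑ i ∈ V, w j i := fun j hj => by
    simp only [w]
    rw [← sum_filter, ← sum_div, le_div_iff₀ hδ, one_mul]
    exact hB j hj
  have hwV : ∀ i ∈ V, ∑ j ∈ B, w j i ≤ 5 / δ * y i := fun i hi => by
    have h1 : T / 5 * (δ * ∑ j ∈ B, w j i) ≤ T * y i := by
      rw [mul_sum, mul_sum]
      refine le_trans (sum_le_sum fun j hj => ?_) (hload i hi)
      simp only [w]
      split_ifs with h
      · rw [mul_zero, mul_zero]
        exact mul_nonneg dist_nonneg (hx i hi j hj)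
      · rw [mul_div_cancel₀ _ hδ.ne']
        exact mul_le_mul_of_nonneg_right (not_le.1 h).le (hx i hi j hj)
    have h2 : δ * ∑ j ∈ B, w j i ≤ 5 * y i := by
      refine le_of_mul_le_mul_left ?_ (by positivity : 0 < T / 5)
      linarith
    rw [div_mul_eq_mul_div, le_div_iff₀ hδ]
    linarith
  obtain ⟨f, hf, hfV⟩ := exists_injective_of_fractional_matching B V w hw hwB fun i hi =>
    (hwV i hi).trans (by
      rw [div_mul_eq_mul_div, div_le_one hδ]
      linarith [hyδ i hi])
  have hm : ∀ j (hj : j ∈ B), (fun j => if h : j ∈ B then f ⟨j, h⟩ else j) j = f ⟨j, hj⟩ :=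
    fun j hj => dif_pos hj
  refine ⟨fun j => if h : j ∈ B then f ⟨j, h⟩ else j, ?_, ?_, ?_⟩
  · intro a ha b hb hab
    rw [hm a ha, hm b hb] at hab
    exact congrArg Subtype.val (hf hab)
  · intro j hj
    rw [hm j hj]
    refine ⟨(hfV _).1, ?_⟩
    have hpos := (hfV ⟨j, hj⟩).2
    simp only [w] at hpos
    split_ifs at hpos with h
    · exact absurd hpos (lt_irrefl _)
    · exact (div_pos_iff_of_pos_right hδ).1 hpos
  · calc (#B : ℝ) = ∑ j ∈ B, (1 : ℝ) := by simp
      _ ≤ ∑ j ∈ B, ∑ i ∈ V, w j i := sum_le_sum hwB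
      _ = ∑ i ∈ V, ∑ j ∈ B, w j i := sum_comm
      _ ≤ ∑ i ∈ V, 5 / δ * y i := sum_le_sum hwV
      _ = 5 / δ * ∑ i ∈ V, y i := (mul_sum _ _ _).symm

open Finset in
/-- Clients receiving a constant fraction of their service from nearby facilities in `V` of small
opening value can be served fractionally by few facilities in `V` with small load. -/
theorem exists_fractional_of_near {X : Type*} [PseudoMetricSpace X] (V C : Finset X)
    (x : X → X → ℝ) (y : X → ℝ) (T r δ M : ℝ) (hT : 0 < T) (hδ : 0 < δ) (hM : 0 < M)
    (hx : ∀ i ∈ V, ∀ j ∈ C, 0 ≤ x i j) (hxy : ∀ i ∈ V, ∀ j ∈ C, x i j ≤ y i)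
    (hy : ∀ i ∈ V, 0 ≤ y i) (hyM : ∀ i ∈ V, y i ≤ M / 2)
    (hload : ∀ i ∈ V, ∑ j ∈ C, dist i j * x i j ≤ T * y i)
    (hC : ∀ j ∈ C, δ ≤ ∑ i ∈ V with dist i j ≤ r, x i j) :
    ∃ (S : Finset X) (z : X → X → ℝ), S ⊆ V ∧ (#S : ℝ) ≤ (2 / M + 2 / δ) * ∑ i ∈ V, y i ∧
      (∀ i, ∀ j ∈ C, 0 ≤ z i j) ∧ (∀ j ∈ C, 1 ≤ ∑ i ∈ S, z i j) ∧
      (∀ i, ∀ j ∈ C, 0 < z i j → dist i j ≤ 5 * r) ∧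
      (∀ i ∈ S, ∑ j ∈ C, dist i j * z i j ≤ 10 / δ * (T * M)) := by
  classical
  let N : X → Finset X := fun j => {i ∈ V | dist i j ≤ r}
  let H : X → Finset X := fun j =>
    {i ∈ N j | (∑ a ∈ N j, x a j) / 2 ≤ ∑ a ∈ N j with dist a j ≤ dist i j, x a j}
  have hNV : ∀ j, N j ⊆ V := fun j => filter_subset _ _
  have hHN : ∀ j, H j ⊆ N j := fun j => filter_subset _ _
  have hHhalf : ∀ j ∈ C, δ / 2 ≤ ∑ i ∈ H j, x i j := fun j hj => by
    have := half_le_sum_upper_half (N j) (fun i => dist i j) (fun i => x i j)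
      fun i hi => hx i (hNV j hi) j hj
    refine le_trans ?_ this
    have := hC j hj
    simp only [N]
    linarith
  let U : Finset X := {i ∈ V | ∃ j ∈ C, i ∈ H j}
  have hUV : U ⊆ V := filter_subset _ _
  have hHU : ∀ j ∈ C, H j ⊆ U := fun j hj i hi =>
    mem_filter.2 ⟨hNV j (hHN j hi), j, hj, hi⟩
  have hnearest : ∀ i ∈ U, ∃ j ∈ C, i ∈ H j ∧ ∀ b ∈ C, i ∈ H b → dist i j ≤ dist i b := by
    intro i hi
    obtain ⟨-, b, hb, hib⟩ := mem_filter.1 hi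
    obtain ⟨j, hj, hmin⟩ := exists_min_image {j ∈ C | i ∈ H j} (fun j => dist i j)
      ⟨b, mem_filter.2 ⟨hb, hib⟩⟩
    exact ⟨j, (mem_filter.1 hj).1, (mem_filter.1 hj).2,
      fun b hb hib => hmin b (mem_filter.2 ⟨hb, hib⟩)⟩
  choose! n hnC hnH hnmin using hnearest
  obtain ⟨π, hπ, hdist, hmass, hcard⟩ := exists_small_capacitated_clustering y
    (fun i => 2 * dist i (n i)) M (δ / 2) hM (by positivity) U V hUV
    (fun i _ => by positivity) hy (fun i hi => hyM i (hUV hi)) fun i hi => by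
      calc δ / 2 ≤ (∑ a ∈ N (n i), x a (n i)) / 2 := by
            have := hC (n i) (hnC i hi)
            simp only [N]
            linarith
        _ ≤ ∑ a ∈ N (n i) with dist a (n i) ≤ dist i (n i), x a (n i) :=
            (mem_filter.1 (hnH i hi)).2
        _ ≤ ∑ a ∈ N (n i) with dist a (n i) ≤ dist i (n i), y a :=
            sum_le_sum fun a ha => hxy a (hNV _ (mem_filter.1 ha).1) _ (hnC i hi)
        _ ≤ ∑ a ∈ V with dist i a ≤ 2 * dist i (n i), y a := by
            refine sum_le_sum_of_subset_of_nonneg (fun a ha => ?_)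
              fun a ha _ => hy a (mem_filter.1 ha).1
            obtain ⟨haN, had⟩ := mem_filter.1 ha
            refine mem_filter.2 ⟨hNV _ haN, ?_⟩
            linarith [dist_triangle_right i a (n i)]
  have hreroute : ∀ j ∈ C, ∀ a ∈ H j, dist (π a) j ≤ 5 * dist a j := fun j hj a ha => by
    have haU := hHU j hj ha
    linarith [dist_triangle_left (π a) j a, hdist a haU, hnmin a haU j hj ha]
  let z : X → X → ℝ := fun i j => ∑ a ∈ H j with π a = i, 2 / δ * x a j
  have hxH : ∀ j ∈ C, ∀ a ∈ H j, 0 ≤ 2 / δ * x a j := fun j hj a ha =>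
    mul_nonneg (by positivity) (hx a (hNV _ (hHN _ ha)) j hj)
  refine ⟨U.image π, z, ?_, ?_, ?_, ?_, ?_, ?_⟩
  · exact image_subset_iff.2 fun i hi => hUV (hπ i hi)
  · rwa [one_div_div] at hcard
  · exact fun i j hj => sum_nonneg fun a ha => hxH j hj a (mem_filter.1 ha).1
  · intro j hj
    simp only [z]
    rw [sum_fiberwise_of_maps_to (fun a ha => mem_image_of_mem π (hHU j hj ha)), ← mul_sum,
      div_mul_eq_mul_div, le_div_iff₀ hδ]
    linarith [hHhalf j hj]
  · intro i j hj hpos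
    obtain ⟨a, ha⟩ : ({a ∈ H j | π a = i} : Finset X).Nonempty := by
      by_contra hne
      simp only [z, not_nonempty_iff_eq_empty.1 hne, sum_empty, lt_irrefl] at hpos
    obtain ⟨haH, rfl⟩ := mem_filter.1 ha
    linarith [hreroute j hj a haH, (mem_filter.1 (hHN j haH)).2]
  · intro i hi
    have hiU : i ∈ U := by
      obtain ⟨a, ha, rfl⟩ := mem_image.1 hi
      exact hπ a ha
    calc ∑ j ∈ C, dist i j * z i j
        ≤ ∑ j ∈ C, ∑ a ∈ U with π a = i, 10 / δ * (dist a j * x a j) := by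
          refine sum_le_sum fun j hj => ?_
          simp only [z]
          rw [mul_sum]
          calc ∑ a ∈ H j with π a = i, dist i j * (2 / δ * x a j)
              ≤ ∑ a ∈ H j with π a = i, 10 / δ * (dist a j * x a j) := by
                refine sum_le_sum fun a ha => ?_
                obtain ⟨haH, rfl⟩ := mem_filter.1 ha
                calc dist (π a) j * (2 / δ * x a j)
                    ≤ 5 * dist a j * (2 / δ * x a j) :=
                      mul_le_mul_of_nonneg_right (hreroute j hj a haH) (hxH j hj a haH)
                  _ = 10 / δ * (dist a j * x a j) := by ring
            _ ≤ ∑ a ∈ U with π a = i, 10 / δ * (dist a j * x a j) :=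
                sum_le_sum_of_subset_of_nonneg (filter_subset_filter _ (hHU j hj))
                  fun a ha _ => mul_nonneg (by positivity)
                    (mul_nonneg dist_nonneg (hx a (hUV (mem_filter.1 ha).1) j hj))
      _ = 10 / δ * ∑ a ∈ U with π a = i, ∑ j ∈ C, dist a j * x a j := by
          rw [sum_comm, mul_sum]
          exact sum_congr rfl fun a _ => (mul_sum _ _ _).symm
      _ ≤ 10 / δ * ∑ a ∈ U with π a = i, T * y a := by
          refine mul_le_mul_of_nonneg_left (sum_le_sum fun a ha => ?_) (by positivity)
          exact hload a (hUV (mem_filter.1 ha).1)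
      _ ≤ 10 / δ * (T * M) := by
          rw [← mul_sum]
          gcongr
          exact hmass i hiU

open Finset in
/-- The fractional solution obtained by opening few facilities completely. -/
theorem SCLPFeasible.exists_fractional_assignment {X : Type*} [MetricSpace X] {F C : Finset X}
    {T : ℝ} {k : ℕ} {x : X → X → ℝ} {y : X → ℝ} (h : SCLPFeasible F C T k x y) (hT : 0 < T)
    {ε : ℝ} (hε0 : 0 < ε) (hε1 : ε < 1) :
    ∃ (O : Finset X) (z : X → X → ℝ), O ⊆ F ∧ (#O : ℝ) ≤ 200 / ε ^ 2 * k ∧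
      (∀ i ∈ O, ∀ j ∈ C, 0 ≤ z i j) ∧ (∀ j ∈ C, 1 ≤ ∑ i ∈ O, z i j) ∧
      (∀ i ∈ O, ∀ j ∈ C, 0 < z i j → dist i j ≤ T) ∧
      (∀ i ∈ O, ∑ j ∈ C, dist i j * z i j ≤ (1 + ε) * T) := by
  classical
  obtain ⟨hx, hy, hload, hk, hsum, hxy, hfar⟩ := h
  have hdist : ∀ i ∈ F, ∀ j ∈ C, 0 < x i j → dist i j ≤ T := fun i hi j hj hpos => by
    by_contra hd
    exact hpos.ne' (hfar i hi j hj (not_le.1 hd))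
  have hloadsub : ∀ D ⊆ C, ∀ i ∈ F, ∑ j ∈ D, dist i j * x i j ≤ T * y i := fun D hD i hi =>
    (sum_le_sum_of_subset_of_nonneg hD fun j hj _ =>
      mul_nonneg dist_nonneg (hx i hi j hj).1).trans (hload i hi)
  have hysub : ∀ D ⊆ F, ∑ i ∈ D, y i ≤ k := fun D hD =>
    (sum_le_sum_of_subset_of_nonneg hD fun i hi _ => (hy i hi).1).trans hk
  let V : Finset X := {i ∈ F | y i ≤ ε ^ 2 / 80}
  let H : Finset X := {i ∈ F | ¬ y i ≤ ε ^ 2 / 80}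
  have hVF : V ⊆ F := filter_subset _ _
  have hHF : H ⊆ F := filter_subset _ _
  have hVH : ∀ i ∈ V, i ∉ H := fun i hi hi' => (mem_filter.1 hi').2 (mem_filter.1 hi).2
  let A : Finset X := {j ∈ C | 1 ≤ (1 + ε) * ∑ i ∈ H, x i j}
  let B : Finset X := {j ∈ C | ε / 4 ≤ ∑ i ∈ V with ¬ dist i j ≤ T / 5, x i j}
  let D : Finset X := {j ∈ C | ε / 4 ≤ ∑ i ∈ V with dist i j ≤ T / 5, x i j}
  have hBC : B ⊆ C := filter_subset _ _
  have hDC : D ⊆ C := filter_subset _ _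
  have hcover : ∀ j ∈ C, j ∈ A ∨ j ∈ B ∨ j ∈ D := by
    intro j hj
    by_contra hcon
    simp only [A, B, D, mem_filter, hj, true_and, not_or] at hcon
    obtain ⟨hA, hB, hD⟩ := hcon
    rw [not_le] at hA hB hD
    have h1 : ∑ i ∈ V, x i j + ∑ i ∈ H, x i j = 1 :=
      (sum_filter_add_sum_filter_not F _ _).trans (hsum j hj)
    have h2 := sum_filter_add_sum_filter_not V (fun i => dist i j ≤ T / 5) (fun i => x i j)
    have h3 : 1 - ε / 2 < ∑ i ∈ H, x i j := by linarith
    nlinarith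
  obtain ⟨m, hminj, hmV, hBcard⟩ := exists_matching_of_far V B x y T (ε / 4) hT (by positivity)
    (fun i hi j hj => (hx i (hVF hi) j (hBC hj)).1)
    (fun i hi => (mem_filter.1 hi).2.trans (by nlinarith))
    (fun i hi => hloadsub B hBC i (hVF hi)) (fun j hj => (mem_filter.1 hj).2)
  obtain ⟨S, z, hSV, hScard, hz0, hz1, hzT, hzload⟩ := exists_fractional_of_near V D x y T (T / 5)
    (ε / 4) (ε ^ 2 / 40) hT (by positivity) (by positivity)
    (fun i hi j hj => (hx i (hVF hi) j (hDC hj)).1)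
    (fun i hi j hj => hxy i (hVF hi) j (hDC hj)) (fun i hi => (hy i (hVF hi)).1)
    (fun i hi => (mem_filter.1 hi).2.trans (by linarith))
    (fun i hi => hloadsub D hDC i (hVF hi)) (fun j hj => (mem_filter.1 hj).2)
  have hHcard : (#H : ℝ) ≤ 80 / ε ^ 2 * k := by
    have h1 : (#H : ℝ) * (ε ^ 2 / 80) ≤ k := by
      calc (#H : ℝ) * (ε ^ 2 / 80) = ∑ i ∈ H, ε ^ 2 / 80 := by simp
        _ ≤ ∑ i ∈ H, y i := sum_le_sum fun i hi => (not_le.1 (mem_filter.1 hi).2).le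
        _ ≤ k := hysub H hHF
    rw [div_mul_eq_mul_div, le_div_iff₀ (by positivity)]
    linarith
  let zA : X → X → ℝ := fun i j => if i ∈ H ∧ j ∈ A then (1 + ε) * x i j else 0
  let zB : X → X → ℝ := fun i j => if j ∈ B ∧ m j = i then 1 else 0
  let zD : X → X → ℝ := fun i j => if i ∈ S ∧ j ∈ D then z i j else 0
  have hzA0 : ∀ i, ∀ j ∈ C, 0 ≤ zA i j := fun i j hj => by
    simp only [zA]
    split_ifs with hi
    · exact mul_nonneg (by linarith) (hx i (hHF hi.1) j hj).1
    · exact le_rfl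
  have hzB0 : ∀ i j, 0 ≤ zB i j := fun i j => by
    simp only [zB]
    split_ifs <;> norm_num
  have hzD0 : ∀ i j, 0 ≤ zD i j := fun i j => by
    simp only [zD]
    split_ifs with hi
    · exact hz0 i j hi.2
    · exact le_rfl
  have hloadA : ∀ i, ∑ j ∈ C, dist i j * zA i j ≤ if i ∈ H then (1 + ε) * T else 0 := by
    intro i
    by_cases hi : i ∈ H
    · rw [if_pos hi]
      calc ∑ j ∈ C, dist i j * zA i j ≤ ∑ j ∈ C, (1 + ε) * (dist i j * x i j) := by
            refine sum_le_sum fun j hj => ?_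
            have h0 := (hx i (hHF hi) j hj).1
            simp only [zA]
            split_ifs
            · exact le_of_eq (by ring)
            · rw [mul_zero]
              positivity
        _ ≤ (1 + ε) * (T * y i) := by
            rw [← mul_sum]
            exact mul_le_mul_of_nonneg_left (hload i (hHF hi)) (by linarith)
        _ ≤ (1 + ε) * T := by
            refine mul_le_mul_of_nonneg_left ?_ (by linarith)
            exact mul_le_of_le_one_right hT.le (hy i (hHF hi)).2
    · simp [zA, hi]
  have hloadB : ∀ i, ∑ j ∈ C, dist i j * zB i j ≤ if i ∈ H then 0 else T := by
    intro i
    by_cases hi : ∃ j ∈ B, m j = i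
    · obtain ⟨j, hj, rfl⟩ := hi
      rw [if_neg (hVH _ (hmV j hj).1), sum_eq_single_of_mem j (hBC hj)]
      · simp only [zB]
        rw [if_pos ⟨hj, trivial⟩, mul_one]
        exact hdist _ (hVF (hmV j hj).1) j (hBC hj) (hmV j hj).2
      · intro b _ hbj
        simp only [zB]
        rw [if_neg fun hb => hbj (hminj hb.1 hj hb.2), mul_zero]
    · rw [sum_eq_zero]
      · split_ifs
        exacts [le_rfl, hT.le]
      · intro j _
        simp only [zB]
        rw [if_neg fun hb => hi ⟨j, hb⟩, mul_zero]
  have hloadD : ∀ i, ∑ j ∈ C, dist i j * zD i j ≤ if i ∈ H then 0 else ε * T := by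
    intro i
    by_cases hi : i ∈ S
    · rw [if_neg (hVH i (hSV hi))]
      calc ∑ j ∈ C, dist i j * zD i j = ∑ j ∈ D, dist i j * z i j := by
            rw [← sum_subset hDC]
            · refine sum_congr rfl fun j hj => ?_
              simp only [zD]
              rw [if_pos ⟨hi, hj⟩]
            · intro j _ hj
              simp only [zD]
              rw [if_neg fun hb => hj hb.2, mul_zero]
        _ ≤ 10 / (ε / 4) * (T * (ε ^ 2 / 40)) := hzload i hi
        _ = ε * T := by
            field_simp
            norm_num
    · rw [sum_eq_zero]
      · split_ifs
        exacts [le_rfl, by positivity]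
      · intro j _
        simp only [zD]
        rw [if_neg fun hb => hi hb.1, mul_zero]
  refine ⟨H ∪ (B.image m ∪ S), fun i j => zA i j + zB i j + zD i j, ?_, ?_, ?_, ?_, ?_, ?_⟩
  · refine union_subset hHF (union_subset ?_ (hSV.trans hVF))
    exact image_subset_iff.2 fun j hj => hVF (hmV j hj).1
  · have h1 : (#(H ∪ (B.image m ∪ S)) : ℝ) ≤ #H + (#B + #S) := by
      have h2 := card_union_le H (B.image m ∪ S)
      have h3 := card_union_le (B.image m) S
      have h4 := card_image_le (s := B) (f := m)
      exact_mod_cast (by omega : #(H ∪ (B.image m ∪ S)) ≤ #H + (#B + #S))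
    have hV := hysub V hVF
    have hB' : (#B : ℝ) ≤ 20 / ε ^ 2 * k := by
      refine hBcard.trans (mul_le_mul ?_ hV (sum_nonneg fun i hi => (hy i (hVF hi)).1)
        (by positivity))
      rw [div_le_div_iff₀ (by positivity) (by positivity)]
      nlinarith
    have hS' : (#S : ℝ) ≤ 100 / ε ^ 2 * k := by
      refine hScard.trans (mul_le_mul ?_ hV (sum_nonneg fun i hi => (hy i (hVF hi)).1)
        (by positivity))
      have e1 : 2 / (ε ^ 2 / 40) + 2 / (ε / 4) = (80 + 8 * ε) / ε ^ 2 := by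
        field_simp
        ring
      rw [e1]
      gcongr
      linarith
    calc (#(H ∪ (B.image m ∪ S)) : ℝ) ≤ #H + (#B + #S) := h1
      _ ≤ 80 / ε ^ 2 * k + (20 / ε ^ 2 * k + 100 / ε ^ 2 * k) := by gcongr
      _ = 200 / ε ^ 2 * k := by ring
  · exact fun i _ j hj => add_nonneg (add_nonneg (hzA0 i j hj) (hzB0 i j)) (hzD0 i j)
  · intro j hj
    rw [sum_add_distrib, sum_add_distrib]
    have hA0 : 0 ≤ ∑ i ∈ H ∪ (B.image m ∪ S), zA i j := sum_nonneg fun i _ => hzA0 i j hj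
    have hB0 : 0 ≤ ∑ i ∈ H ∪ (B.image m ∪ S), zB i j := sum_nonneg fun i _ => hzB0 i j
    have hD0 : 0 ≤ ∑ i ∈ H ∪ (B.image m ∪ S), zD i j := sum_nonneg fun i _ => hzD0 i j
    rcases hcover j hj with hjA | hjB | hjD
    · have : 1 ≤ ∑ i ∈ H ∪ (B.image m ∪ S), zA i j := by
        calc 1 ≤ (1 + ε) * ∑ i ∈ H, x i j := (mem_filter.1 hjA).2
          _ = ∑ i ∈ H, zA i j := by
            rw [mul_sum]
            refine sum_congr rfl fun i hi => ?_
            simp only [zA]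
            rw [if_pos ⟨hi, hjA⟩]
          _ ≤ _ := sum_le_sum_of_subset_of_nonneg subset_union_left fun i _ _ => hzA0 i j hj
      linarith
    · have : 1 ≤ ∑ i ∈ H ∪ (B.image m ∪ S), zB i j := by
        calc 1 = zB (m j) j := by
              simp only [zB]
              rw [if_pos ⟨hjB, trivial⟩]
          _ ≤ _ := single_le_sum (f := fun i => zB i j) (fun i _ => hzB0 i j)
              (mem_union_right _ (mem_union_left _ (mem_image_of_mem m hjB)))
      linarith
    · have : 1 ≤ ∑ i ∈ H ∪ (B.image m ∪ S), zD i j := by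
        calc 1 ≤ ∑ i ∈ S, z i j := hz1 j hjD
          _ = ∑ i ∈ S, zD i j := by
            refine sum_congr rfl fun i hi => ?_
            simp only [zD]
            rw [if_pos ⟨hi, hjD⟩]
          _ ≤ _ := sum_le_sum_of_subset_of_nonneg
            (subset_union_right.trans subset_union_right) fun i _ _ => hzD0 i j
      linarith
  · intro i _ j hj hpos
    by_contra hd
    have hA' : zA i j = 0 := by
      simp only [zA]
      split_ifs with hi
      · rw [hfar i (hHF hi.1) j hj (not_le.1 hd), mul_zero]
      · rfl
    have hB' : zB i j = 0 := by
      simp only [zB]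
      refine if_neg ?_
      rintro ⟨hjB, rfl⟩
      exact hd (hdist _ (hVF (hmV j hjB).1) j hj (hmV j hjB).2)
    have hD' : zD i j = 0 := by
      simp only [zD]
      split_ifs with hi
      · refine le_antisymm (not_lt.1 fun hz => hd ?_) (hz0 i j hi.2)
        linarith [hzT i j hi.2 hz]
      · rfl
    simp [hA', hB', hD'] at hpos
  · intro i _
    have hA' := hloadA i
    have hB' := hloadB i
    have hD' := hloadD i
    simp only [mul_add, sum_add_distrib]
    split_ifs at hA' hB' hD' <;> linarith

/-- Rounding of SC-LP with `O(1/ε²)·k` opened facilities and `(2+ε)·T` loads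
(Theorem 5 / `scsize` of the paper, combined with makespan rounding). -/
theorem sclp_rounding_size :
    ∃ c : ℝ, 0 < c ∧
      ∀ (X : Type) [MetricSpace X] (F C : Finset X), Disjoint F C →
        ∀ (T : ℝ), 0 < T → ∀ (k : ℕ) (x : X → X → ℝ) (y : X → ℝ),
          SCLPFeasible F C T k x y →
            ∀ ε : ℝ, 0 < ε → ε < 1 →
              ∃ (xh : X → X → ℝ) (yh : X → ℝ),
                (∀ i ∈ F, ∀ j ∈ C, xh i j = 0 ∨ xh i j = 1) ∧
                (∀ i ∈ F, yh i = 0 ∨ yh i = 1) ∧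
                (∀ j ∈ C, ∑ i ∈ F, xh i j = 1) ∧
                (∀ i ∈ F, ∀ j ∈ C, xh i j ≤ yh i) ∧
                (∑ i ∈ F, yh i ≤ (c / ε ^ 2) * k) ∧
                (∀ i ∈ F, ∑ j ∈ C, dist i j * xh i j ≤ (2 + ε) * T * yh i) := by
  classical
  refine ⟨200, by norm_num, fun X _ F C _ T hT k x y h ε hε0 hε1 => ?_⟩
  obtain ⟨O, z, hOF, hcard, hz0, hz1, hzT, hload⟩ :=
    h.exists_fractional_assignment hT hε0 hε1
  obtain ⟨f, hfO, hf⟩ := exists_integral_assignment O C dist z ((1 + ε) * T) T hT.le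
    (fun _ _ _ _ => dist_nonneg) hz0 hz1 hzT hload
  let xh : X → X → ℝ := fun i j => if ∃ hj : j ∈ C, f ⟨j, hj⟩ = i then 1 else 0
  have hxh : ∀ (i : X) (j : C), xh i j = if f j = i then 1 else 0 := fun i j => by
    simp [xh]
  have hxh_sum : ∀ i, ∑ j ∈ C, dist i j * xh i j = ∑ j : C with f j = i, dist i j := by
    intro i
    rw [← Finset.sum_coe_sort C, Finset.sum_filter]
    exact Finset.sum_congr rfl fun j _ => by rw [hxh, mul_ite, mul_one, mul_zero]
  refine ⟨xh, fun i => if i ∈ O then 1 else 0, ?_, ?_, ?_, ?_, ?_, ?_⟩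
  · intro i _ j _
    simp only [xh]
    split_ifs <;> simp
  · intro i _
    dsimp only
    split_ifs <;> simp
  · intro j hj
    simp_rw [hxh _ ⟨j, hj⟩]
    rw [Finset.sum_ite_eq, if_pos (hOF (hfO _))]
  · intro i _ j hj
    dsimp only
    rw [hxh i ⟨j, hj⟩]
    by_cases hi : f ⟨j, hj⟩ = i
    · rw [if_pos hi, if_pos (hi ▸ hfO _)]
    · rw [if_neg hi]
      split_ifs <;> norm_num
  · rw [Finset.sum_ite_mem, Finset.inter_eq_right.2 hOF]
    simpa using hcard
  · intro i _
    dsimp only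
    rw [hxh_sum]
    by_cases hi : i ∈ O
    · rw [if_pos hi]
      linarith [hf i hi]
    · rw [if_neg hi, Finset.filter_false_of_mem (p := fun j => f j = i)
        fun j _ hj => hi (hj ▸ hfO j)]
      simp
end
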